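/- arXiv:1909.01994 — 4 statements merged into one kernel-verified Lean document; each statement's English description precedes it below -/
import Mathlib

section
/- Let B be a real symmetric n×n matrix, g ∈ ℝⁿ, and δ > 0, and define the quadratic model Q(p) = gᵀp + (1/2)pᵀBp. Suppose p* ∈ ℝⁿ and σ* ∈ ℝ satisfy: ‖p*‖₂ ≤ δ, σ* ≥ 0, B + σ*I is positive semidefinite, (B + σ*I)p* = −g, and σ*(δ − ‖p*‖₂) = 0. Then p* is a global solution of the trust-region subproblem, i.e., Q(p*) ≤ Q(p) for every p ∈ ℝⁿ with ‖p‖₂ ≤ δ. -/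
open Matrix

/-- If `p*` and `σ* ≥ 0` satisfy the optimality conditions `‖p*‖₂ ≤ δ`,
`B + σ*I` positive semidefinite, `(B + σ*I)p* = -g` and `σ*(δ - ‖p*‖₂) = 0`,
then `p*` is a global solution of the trust-region subproblem. -/
theorem trust_region_sufficiency (n : ℕ) (B : Matrix (Fin n) (Fin n) ℝ) (hB : B.IsSymm)
    (g : Fin n → ℝ) (δ : ℝ) (hδ : 0 < δ)
    (pstar : Fin n → ℝ) (σ : ℝ)
    (hnorm : Real.sqrt (pstar ⬝ᵥ pstar) ≤ δ)
    (hσ : 0 ≤ σ)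
    (hpsd : (B + σ • (1 : Matrix (Fin n) (Fin n) ℝ)).PosSemidef)
    (heq : (B + σ • (1 : Matrix (Fin n) (Fin n) ℝ)) *ᵥ pstar = -g)
    (hcomp : σ * (δ - Real.sqrt (pstar ⬝ᵥ pstar)) = 0) :
    ∀ p : Fin n → ℝ, Real.sqrt (p ⬝ᵥ p) ≤ δ →
      g ⬝ᵥ pstar + (1 / 2) * (pstar ⬝ᵥ (B *ᵥ pstar)) ≤
        g ⬝ᵥ p + (1 / 2) * (p ⬝ᵥ (B *ᵥ p)) := by
  intro p hp
  have hM : ∀ x : Fin n → ℝ,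
      (B + σ • (1 : Matrix (Fin n) (Fin n) ℝ)) *ᵥ x = B *ᵥ x + σ • x := fun x => by
    rw [add_mulVec, smul_mulVec, one_mulVec]
  have hsymm : pstar ⬝ᵥ (B *ᵥ p) = p ⬝ᵥ (B *ᵥ pstar) := by
    rw [dotProduct_mulVec, ← mulVec_transpose, hB.eq, dotProduct_comm]
  have hquad := (posSemidef_iff_dotProduct_mulVec.mp hpsd).2 (p - pstar)
  rw [hM] at heq
  simp only [hM, star_trivial, mulVec_sub, smul_sub, dotProduct_add, dotProduct_sub,
    sub_dotProduct, dotProduct_smul, smul_eq_mul, hsymm, dotProduct_comm pstar p] at hquad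
  have h_p := congrArg (p ⬝ᵥ ·) heq
  have h_pstar := congrArg (pstar ⬝ᵥ ·) heq
  simp only [dotProduct_add, dotProduct_smul, dotProduct_neg, smul_eq_mul] at h_p h_pstar
  rw [dotProduct_comm p g] at h_p
  rw [dotProduct_comm pstar g] at h_pstar
  have hball : p ⬝ᵥ p ≤ δ ^ 2 := (Real.sqrt_le_left hδ.le).mp hp
  have hnonneg : 0 ≤ pstar ⬝ᵥ pstar := by
    simpa using dotProduct_star_self_nonneg pstar
  have hslack : σ * (pstar ⬝ᵥ pstar) = σ * δ ^ 2 := by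
    rcases mul_eq_zero.mp hcomp with h | h
    · simp [h]
    · rw [sub_eq_zero.mp h, Real.sq_sqrt hnonneg]
  have hσp := mul_le_mul_of_nonneg_left hball hσ
  linarith
end

section
/- Let B be a real symmetric n×n matrix, g ∈ ℝⁿ, and δ > 0, and define the quadratic model Q(p) = gᵀp + (1/2)pᵀBp. If p* is a global solution of the trust-region subproblem, i.e. ‖p*‖₂ ≤ δ and Q(p*) ≤ Q(p) for all p with ‖p‖₂ ≤ δ, then there exists a unique σ* ≥ 0 such that B + σ*I is positive semidefinite, (B + σ*I)p* = −g, and σ*(δ − ‖p*‖₂) = 0. -/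
open Matrix Filter Topology

/-- A quadratic polynomial that is nonnegative just to the right of `0` is nonnegative at `0`. -/
lemma nonneg_of_eventually_quadratic_nonneg {a b c : ℝ}
    (h : ∀ᶠ s in 𝓝[>] (0 : ℝ), 0 ≤ a + b * s + c * s ^ 2) : 0 ≤ a := by
  have hc : Continuous fun s : ℝ => a + b * s + c * s ^ 2 := by fun_prop
  have ht : Tendsto (fun s : ℝ => a + b * s + c * s ^ 2) (𝓝[>] 0) (𝓝 a) := by
    simpa using (hc.tendsto 0).mono_left nhdsWithin_le_nhds
  exact ge_of_tendsto ht h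

/-- A quadratic polynomial that is positive at `0` is positive just to the right of `0`. -/
lemma eventually_quadratic_pos {a b c : ℝ} (ha : 0 < a) :
    ∀ᶠ s in 𝓝[>] (0 : ℝ), 0 < a + b * s + c * s ^ 2 := by
  have hc : Continuous fun s : ℝ => a + b * s + c * s ^ 2 := by fun_prop
  have ht : Tendsto (fun s : ℝ => a + b * s + c * s ^ 2) (𝓝[>] 0) (𝓝 a) := by
    simpa using (hc.tendsto 0).mono_left nhdsWithin_le_nhds
  exact ht.eventually (eventually_gt_nhds ha)

lemma dotProduct_self_add_smul {ι : Type*} [Fintype ι] (p d : ι → ℝ) (s : ℝ) :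
    (p + s • d) ⬝ᵥ (p + s • d) = p ⬝ᵥ p + 2 * s * (p ⬝ᵥ d) + s ^ 2 * (d ⬝ᵥ d) := by
  simp only [add_dotProduct, dotProduct_add, smul_dotProduct, dotProduct_smul, smul_eq_mul,
    dotProduct_comm d p]
  ring

lemma Matrix.IsSymm.dotProduct_mulVec_comm {ι : Type*} [Fintype ι] {B : Matrix ι ι ℝ}
    (hB : B.IsSymm) (x y : ι → ℝ) : x ⬝ᵥ (B *ᵥ y) = y ⬝ᵥ (B *ᵥ x) := by
  rw [dotProduct_mulVec, ← mulVec_transpose, hB.eq, dotProduct_comm]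

lemma Matrix.IsSymm.quadraticModel_add_smul {ι : Type*} [Fintype ι] {B : Matrix ι ι ℝ}
    (hB : B.IsSymm) (g p d : ι → ℝ) (s : ℝ) :
    g ⬝ᵥ (p + s • d) + (1 / 2) * ((p + s • d) ⬝ᵥ (B *ᵥ (p + s • d))) =
      g ⬝ᵥ p + (1 / 2) * (p ⬝ᵥ (B *ᵥ p)) +
        (s * ((B *ᵥ p + g) ⬝ᵥ d) + s ^ 2 / 2 * (d ⬝ᵥ (B *ᵥ d))) := by
  simp only [mulVec_add, mulVec_smul, add_dotProduct, dotProduct_add, smul_dotProduct,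
    dotProduct_smul, smul_eq_mul, hB.dotProduct_mulVec_comm p d, dotProduct_comm (B *ᵥ p) d]
  ring

/-- Regularising a matrix by `σ • 1` adds `σ` times the squared norm to its quadratic form. -/
lemma Matrix.dotProduct_add_smul_one_mulVec {ι : Type*} [Fintype ι] [DecidableEq ι]
    (B : Matrix ι ι ℝ) (σ : ℝ) (d : ι → ℝ) :
    d ⬝ᵥ ((B + σ • (1 : Matrix ι ι ℝ)) *ᵥ d) = d ⬝ᵥ (B *ᵥ d) + σ * (d ⬝ᵥ d) := by
  simp [add_mulVec, smul_mulVec, dotProduct_add, dotProduct_smul]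

section TrustRegion

variable {ι : Type*} [Fintype ι] {B : Matrix ι ι ℝ} {g p : ι → ℝ} {r : ℝ}

/-- At a minimizer of the quadratic model, the model does not decrease to first order along any
direction that stays feasible. -/
lemma gradient_dotProduct_nonneg
    (hmin : ∀ d : ι → ℝ, ∀ s : ℝ, (p + s • d) ⬝ᵥ (p + s • d) ≤ r →
      0 ≤ s * ((B *ᵥ p + g) ⬝ᵥ d) + s ^ 2 / 2 * (d ⬝ᵥ (B *ᵥ d)))
    {d : ι → ℝ} (hd : ∀ᶠ s in 𝓝[>] (0 : ℝ), (p + s • d) ⬝ᵥ (p + s • d) ≤ r) :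
    0 ≤ (B *ᵥ p + g) ⬝ᵥ d := by
  refine nonneg_of_eventually_quadratic_nonneg (b := (d ⬝ᵥ (B *ᵥ d)) / 2) (c := 0) ?_
  filter_upwards [hd, self_mem_nhdsWithin] with s hs hs0
  have hs0 : 0 < s := hs0
  have h := hmin d s hs
  refine nonneg_of_mul_nonneg_right (a := s) ?_ hs0
  linarith

/-- At an interior minimizer the gradient vanishes and the Hessian is positive semidefinite. -/
lemma optimality_of_interior (hp : p ⬝ᵥ p < r)
    (hmin : ∀ d : ι → ℝ, ∀ s : ℝ, (p + s • d) ⬝ᵥ (p + s • d) ≤ r →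
      0 ≤ s * ((B *ᵥ p + g) ⬝ᵥ d) + s ^ 2 / 2 * (d ⬝ᵥ (B *ᵥ d))) :
    B *ᵥ p + g = 0 ∧ ∀ d : ι → ℝ, 0 ≤ d ⬝ᵥ (B *ᵥ d) := by
  have feas : ∀ d : ι → ℝ, ∀ᶠ s in 𝓝[>] (0 : ℝ), (p + s • d) ⬝ᵥ (p + s • d) ≤ r := by
    intro d
    filter_upwards [eventually_quadratic_pos (b := -2 * (p ⬝ᵥ d)) (c := -(d ⬝ᵥ d))
      (sub_pos.2 hp)] with s hs
    rw [dotProduct_self_add_smul]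
    linarith
  have hgrad : B *ᵥ p + g = 0 := by
    have h := gradient_dotProduct_nonneg hmin (feas (-(B *ᵥ p + g)))
    rw [dotProduct_neg] at h
    exact dotProduct_self_eq_zero.1 (le_antisymm (by linarith) (by simpa using dotProduct_star_self_nonneg (B *ᵥ p + g)))
  refine ⟨hgrad, fun d => ?_⟩
  obtain ⟨s, hs, hs0⟩ := ((feas d).and self_mem_nhdsWithin).exists
  have hs0 : 0 < s := hs0
  have h := hmin d s hs
  rw [hgrad, zero_dotProduct, mul_zero, zero_add] at h
  exact nonneg_of_mul_nonneg_right h (by positivity)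

/-- At a minimizer on the boundary sphere the gradient is a nonpositive multiple of the
minimizer. -/
lemma exists_multiplier_of_boundary (hr : 0 < r) (hp : p ⬝ᵥ p = r)
    (hmin : ∀ d : ι → ℝ, ∀ s : ℝ, (p + s • d) ⬝ᵥ (p + s • d) ≤ r →
      0 ≤ s * ((B *ᵥ p + g) ⬝ᵥ d) + s ^ 2 / 2 * (d ⬝ᵥ (B *ᵥ d))) :
    ∃ σ : ℝ, 0 ≤ σ ∧ B *ᵥ p + g + σ • p = 0 := by
  have inward : ∀ d : ι → ℝ, p ⬝ᵥ d < 0 → 0 ≤ (B *ᵥ p + g) ⬝ᵥ d := by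
    intro d hd
    refine gradient_dotProduct_nonneg hmin ?_
    filter_upwards [eventually_quadratic_pos (a := -2 * (p ⬝ᵥ d)) (b := -(d ⬝ᵥ d)) (c := 0)
      (by linarith), self_mem_nhdsWithin] with s hs hs0
    have hs0 : 0 < s := hs0
    rw [dotProduct_self_add_smul, hp]
    nlinarith [mul_pos hs0 hs]
  have hqp : (B *ᵥ p + g) ⬝ᵥ p ≤ 0 := by
    have h := inward (-p) (by rw [dotProduct_neg]; linarith)
    rw [dotProduct_neg] at h
    linarith
  have tangent : ∀ d : ι → ℝ, p ⬝ᵥ d = 0 → 0 ≤ (B *ᵥ p + g) ⬝ᵥ d := by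
    intro d hd
    refine nonneg_of_eventually_quadratic_nonneg (b := -((B *ᵥ p + g) ⬝ᵥ p)) (c := 0) ?_
    filter_upwards [self_mem_nhdsWithin] with s hs
    have hs : 0 < s := hs
    have h := inward (d - s • p) (by
      rw [dotProduct_sub, dotProduct_smul, hd, hp, smul_eq_mul]
      linarith [mul_pos hs hr])
    rw [dotProduct_sub, dotProduct_smul, smul_eq_mul] at h
    linarith
  generalize B *ᵥ p + g = q at *
  have hσ : -(q ⬝ᵥ p) / r * r = -(q ⬝ᵥ p) := div_mul_cancel₀ _ hr.ne'
  refine ⟨-(q ⬝ᵥ p) / r, div_nonneg (by linarith) hr.le, ?_⟩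
  generalize -(q ⬝ᵥ p) / r = σ at *
  have horth : p ⬝ᵥ (q + σ • p) = 0 := by
    rw [dotProduct_add, dotProduct_smul, hp, smul_eq_mul, hσ, dotProduct_comm]
    ring
  have h := tangent (-(q + σ • p)) (by rw [dotProduct_neg, horth, neg_zero])
  rw [dotProduct_neg] at h
  refine dotProduct_self_eq_zero.1 (le_antisymm ?_ (by simpa using dotProduct_star_self_nonneg (q + σ • p)))
  rw [add_dotProduct, smul_dotProduct, horth, smul_zero]
  linarith

/-- At a minimizer on the boundary sphere with multiplier `σ`, the regularised quadratic form is
nonnegative. -/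
lemma regularized_nonneg_of_boundary (hr : 0 < r) (hp : p ⬝ᵥ p = r)
    (hmin : ∀ d : ι → ℝ, ∀ s : ℝ, (p + s • d) ⬝ᵥ (p + s • d) ≤ r →
      0 ≤ s * ((B *ᵥ p + g) ⬝ᵥ d) + s ^ 2 / 2 * (d ⬝ᵥ (B *ᵥ d)))
    {σ : ℝ} (hσ : B *ᵥ p + g + σ • p = 0) (d : ι → ℝ) :
    0 ≤ d ⬝ᵥ (B *ᵥ d) + σ * (d ⬝ᵥ d) := by
  have hq : ∀ d : ι → ℝ, (B *ᵥ p + g) ⬝ᵥ d = -σ * (p ⬝ᵥ d) := by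
    intro d
    rw [eq_neg_of_add_eq_zero_left hσ, neg_dotProduct, smul_dotProduct, smul_eq_mul, neg_mul]
  have transversal : ∀ d : ι → ℝ, p ⬝ᵥ d ≠ 0 → 0 ≤ d ⬝ᵥ (B *ᵥ d) + σ * (d ⬝ᵥ d) := by
    intro d hd
    have hdd : d ⬝ᵥ d ≠ 0 := fun h => hd (by rw [dotProduct_self_eq_zero.1 h, dotProduct_zero])
    obtain ⟨s, hs⟩ : ∃ s : ℝ, s * (d ⬝ᵥ d) = -2 * (p ⬝ᵥ d) := ⟨_, div_mul_cancel₀ _ hdd⟩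
    have hs0 : s ≠ 0 := by
      rintro rfl
      exact hd (by linarith)
    have h := hmin d s (by
      rw [dotProduct_self_add_smul, hp]
      linear_combination s * hs)
    rw [hq] at h
    refine nonneg_of_mul_nonneg_right (a := s ^ 2 / 2) ?_ (by positivity)
    linear_combination h - (σ * s / 2) * hs
  by_cases hd : p ⬝ᵥ d = 0
  · refine nonneg_of_eventually_quadratic_nonneg
      (b := d ⬝ᵥ (B *ᵥ p) + p ⬝ᵥ (B *ᵥ d) + 2 * σ * (d ⬝ᵥ p))
      (c := p ⬝ᵥ (B *ᵥ p) + σ * (p ⬝ᵥ p)) ?_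
    filter_upwards [self_mem_nhdsWithin] with s hs
    have hs : 0 < s := hs
    have h := transversal (d + s • p) (by
      rw [dotProduct_add, dotProduct_smul, hd, hp, smul_eq_mul, zero_add]
      positivity)
    rw [dotProduct_self_add_smul] at h
    simp only [mulVec_add, mulVec_smul, add_dotProduct, dotProduct_add, smul_dotProduct,
      dotProduct_smul, smul_eq_mul] at h
    linarith
  · exact transversal d hd

end TrustRegion

/-- If `p*` is a global solution of the trust-region subproblem
`min Q(p) = gᵀp + (1/2)pᵀBp  s.t. ‖p‖₂ ≤ δ`, then there exists a unique `σ* ≥ 0`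
such that `B + σ*I` is positive semidefinite, `(B + σ*I)p* = -g`, and
`σ*(δ - ‖p*‖₂) = 0`. -/
theorem trust_region_necessity (n : ℕ) (B : Matrix (Fin n) (Fin n) ℝ) (hB : B.IsSymm)
    (g : Fin n → ℝ) (δ : ℝ) (hδ : 0 < δ)
    (pstar : Fin n → ℝ)
    (hnorm : Real.sqrt (pstar ⬝ᵥ pstar) ≤ δ)
    (hglobal : ∀ p : Fin n → ℝ, Real.sqrt (p ⬝ᵥ p) ≤ δ →
      g ⬝ᵥ pstar + (1 / 2) * (pstar ⬝ᵥ (B *ᵥ pstar)) ≤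
        g ⬝ᵥ p + (1 / 2) * (p ⬝ᵥ (B *ᵥ p))) :
    ∃! σ : ℝ, 0 ≤ σ ∧
      (B + σ • (1 : Matrix (Fin n) (Fin n) ℝ)).PosSemidef ∧
      (B + σ • (1 : Matrix (Fin n) (Fin n) ℝ)) *ᵥ pstar = -g ∧
      σ * (δ - Real.sqrt (pstar ⬝ᵥ pstar)) = 0 := by
  have hsqrt : ∀ x : ℝ, Real.sqrt x ≤ δ ↔ x ≤ δ ^ 2 := fun x => Real.sqrt_le_left hδ.le
  have hmin : ∀ d : Fin n → ℝ, ∀ s : ℝ, (pstar + s • d) ⬝ᵥ (pstar + s • d) ≤ δ ^ 2 →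
      0 ≤ s * ((B *ᵥ pstar + g) ⬝ᵥ d) + s ^ 2 / 2 * (d ⬝ᵥ (B *ᵥ d)) := by
    intro d s hs
    have h := hglobal _ ((hsqrt _).2 hs)
    rw [hB.quadraticModel_add_smul] at h
    linarith
  have hexists : ∃ σ : ℝ, 0 ≤ σ ∧ B *ᵥ pstar + g + σ • pstar = 0 ∧
      (∀ d : Fin n → ℝ, 0 ≤ d ⬝ᵥ (B *ᵥ d) + σ * (d ⬝ᵥ d)) ∧
      σ * (δ - Real.sqrt (pstar ⬝ᵥ pstar)) = 0 := by
    rcases ((hsqrt _).1 hnorm).lt_or_eq with hp | hp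
    · obtain ⟨hgrad, hpos⟩ := optimality_of_interior hp hmin
      exact ⟨0, le_rfl, by simpa using hgrad, by simpa using hpos, zero_mul _⟩
    · obtain ⟨σ, hσ0, hσ⟩ := exists_multiplier_of_boundary (by positivity) hp hmin
      refine ⟨σ, hσ0, hσ, regularized_nonneg_of_boundary (by positivity) hp hmin hσ, ?_⟩
      rw [hp, Real.sqrt_sq hδ.le, sub_self, mul_zero]
  obtain ⟨σ, hσ0, hσ, hpos, hcomp⟩ := hexists
  have hstat : ∀ τ : ℝ, (B + τ • (1 : Matrix (Fin n) (Fin n) ℝ)) *ᵥ pstar = -g ↔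
      B *ᵥ pstar + g + τ • pstar = 0 := by
    intro τ
    rw [add_mulVec, smul_mulVec, one_mulVec, eq_neg_iff_add_eq_zero, add_right_comm]
  refine ⟨σ, ⟨hσ0, ?_, (hstat σ).2 hσ, hcomp⟩, ?_⟩
  · refine PosSemidef.of_dotProduct_mulVec_nonneg ?_ fun d => ?_
    · exact isHermitian_iff_isSymm.2 (hB.add (isSymm_one.smul σ))
    · rw [star_trivial, dotProduct_add_smul_one_mulVec]
      exact hpos d
  · rintro τ ⟨-, -, hτ, hτcomp⟩
    by_cases hp : pstar = 0
    · simp only [hp, dotProduct_zero, Real.sqrt_zero, sub_zero, mul_eq_zero, hδ.ne', or_false]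
        at hcomp hτcomp
      rw [hcomp, hτcomp]
    · exact smul_left_injective ℝ hp (add_left_cancel (((hstat τ).1 hτ).trans hσ.symm))
end

section
/- Let B be a real symmetric n×n matrix, g ∈ ℝⁿ, and δ > 0, and define Q(p) = gᵀp + (1/2)pᵀBp. Suppose p* ∈ ℝⁿ and σ* ≥ 0 satisfy ‖p*‖₂ ≤ δ, (B + σ*I)p* = −g, σ*(δ − ‖p*‖₂) = 0, and B + σ*I is positive definite. Then p* is the unique global minimizer of Q over the ball {p : ‖p‖₂ ≤ δ}; that is, Q(p*) < Q(p) for every p ≠ p* with ‖p‖₂ ≤ δ. -/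
open Matrix

/-- If `p*` and `σ* ≥ 0` satisfy the optimality conditions and moreover `B + σ*I` is
positive definite, then `p*` is the unique global minimizer of the trust-region
subproblem: `Q(p*) < Q(p)` for every feasible `p ≠ p*`. -/
theorem trust_region_unique_minimizer (n : ℕ) (B : Matrix (Fin n) (Fin n) ℝ) (hB : B.IsSymm)
    (g : Fin n → ℝ) (δ : ℝ) (hδ : 0 < δ)
    (pstar : Fin n → ℝ) (σ : ℝ)
    (hσ : 0 ≤ σ)
    (hnorm : Real.sqrt (pstar ⬝ᵥ pstar) ≤ δ)
    (heq : (B + σ • (1 : Matrix (Fin n) (Fin n) ℝ)) *ᵥ pstar = -g)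
    (hcomp : σ * (δ - Real.sqrt (pstar ⬝ᵥ pstar)) = 0)
    (hpd : (B + σ • (1 : Matrix (Fin n) (Fin n) ℝ)).PosDef) :
    ∀ p : Fin n → ℝ, Real.sqrt (p ⬝ᵥ p) ≤ δ → p ≠ pstar →
      g ⬝ᵥ pstar + (1 / 2) * (pstar ⬝ᵥ (B *ᵥ pstar)) <
        g ⬝ᵥ p + (1 / 2) * (p ⬝ᵥ (B *ᵥ p)) := by
  intro p hp hne
  have hpos := hpd.dotProduct_mulVec_pos (sub_ne_zero.mpr hne)
  have hdot : ∀ x : Fin n → ℝ, x ⬝ᵥ (B *ᵥ pstar) + σ * (x ⬝ᵥ pstar) = -(g ⬝ᵥ x) := by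
    intro x
    have h := congrArg (x ⬝ᵥ ·) heq
    simpa [Matrix.add_mulVec, Matrix.smul_mulVec, dotProduct_add, dotProduct_comm g x] using h
  have hsymm : pstar ⬝ᵥ (B *ᵥ p) = p ⬝ᵥ (B *ᵥ pstar) := by
    rw [Matrix.dotProduct_mulVec, ← Matrix.mulVec_transpose, hB.eq, dotProduct_comm]
  have hslack : 0 ≤ σ * (pstar ⬝ᵥ pstar - p ⬝ᵥ p) := by
    rcases mul_eq_zero.mp hcomp with h | h
    · simp [h]
    · have hle : Real.sqrt (p ⬝ᵥ p) ≤ Real.sqrt (pstar ⬝ᵥ pstar) := by linarith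
      have hstar : 0 ≤ pstar ⬝ᵥ pstar := by simpa using dotProduct_star_self_nonneg pstar
      exact mul_nonneg hσ (sub_nonneg.mpr ((Real.sqrt_le_sqrt_iff hstar).mp hle))
  simp only [star_trivial, Matrix.add_mulVec, Matrix.smul_mulVec, Matrix.one_mulVec,
    Matrix.mulVec_sub, dotProduct_add, dotProduct_sub, sub_dotProduct, dotProduct_smul,
    smul_eq_mul, hsymm, dotProduct_comm pstar p] at hpos
  linarith [hdot p, hdot pstar]
end

section
/- Let B be a real symmetric positive definite n×n matrix, let s, y ∈ ℝⁿ with sᵀy > 0 and s ≠ 0, let ρ = 1/(yᵀs), and let B⁺ = B − (1/(sᵀBs)) B s sᵀ B + ρ y yᵀ be the BFGS update. Then B⁺ is invertible and its inverse is given by the inverse BFGS formula: (B⁺)⁻¹ = (I − ρ s yᵀ) B⁻¹ (I − ρ y sᵀ) + ρ s sᵀ. -/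
open Matrix

/-- The product of the BFGS update of `B` and the inverse BFGS formula is the identity. -/
theorem bfgs_update_mul_inverse_update {ι K : Type*} [Fintype ι] [DecidableEq ι] [Field K]
    {B : Matrix ι ι K} (hB : B.IsSymm) (hdet : IsUnit B.det) {s y : ι → K}
    (hσ : s ⬝ᵥ (B *ᵥ s) ≠ 0) (hys : y ⬝ᵥ s ≠ 0) :
    (B - (s ⬝ᵥ (B *ᵥ s))⁻¹ • (B * vecMulVec s s * B) + (y ⬝ᵥ s)⁻¹ • vecMulVec y y) *
      ((1 - (y ⬝ᵥ s)⁻¹ • vecMulVec s y) * B⁻¹ * (1 - (y ⬝ᵥ s)⁻¹ • vecMulVec y s) +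
        (y ⬝ᵥ s)⁻¹ • vecMulVec s s) = 1 := by
  have hsB : s ᵥ* B = B *ᵥ s := by rw [← mulVec_transpose, hB.eq]
  have huu : B * vecMulVec s s * B = vecMulVec (B *ᵥ s) (B *ᵥ s) := by
    rw [mul_vecMulVec, vecMulVec_mul, hsB]
  have huinv : (B *ᵥ s) ᵥ* B⁻¹ = s := by
    rw [← hsB, vecMul_vecMul, mul_nonsing_inv B hdet, vecMul_one]
  rw [huu]
  set u := B *ᵥ s with hu
  set σ := s ⬝ᵥ u with hσ_def
  set δ := y ⬝ᵥ s with hδ_def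
  set C := B - σ⁻¹ • vecMulVec u u + δ⁻¹ • vecMulVec y y with hC
  have secant : C *ᵥ s = y := by
    simp [hC, add_mulVec, sub_mulVec, smul_mulVec, vecMulVec_mulVec, smul_smul,
      dotProduct_comm u s, ← hu, ← hσ_def, ← hδ_def, hσ, hys]
  have hleft : C * (1 - δ⁻¹ • vecMulVec s y) = B - σ⁻¹ • vecMulVec u u := by
    rw [mul_sub, mul_one, mul_smul_comm, mul_vecMulVec, secant, hC, add_sub_cancel_right]
  have hmid : (B - σ⁻¹ • vecMulVec u u) * B⁻¹ = 1 - σ⁻¹ • vecMulVec u s := by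
    rw [sub_mul, mul_nonsing_inv B hdet, smul_mul_assoc, vecMulVec_mul, huinv]
  have hzero : vecMulVec u s * (1 - δ⁻¹ • vecMulVec y s) = 0 := by
    rw [mul_sub, mul_one, mul_smul_comm, vecMulVec_mul_vecMulVec, dotProduct_comm s y,
      ← hδ_def, vecMulVec_smul, smul_smul, inv_mul_cancel₀ hys, one_smul, sub_self]
  rw [mul_add, ← mul_assoc, ← mul_assoc, hleft, hmid, sub_mul, one_mul, smul_mul_assoc, hzero,
    smul_zero, sub_zero, mul_smul_comm, mul_vecMulVec, secant, sub_add_cancel]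

/-- The inverse BFGS formula: if `B` is symmetric positive definite, `sᵀy > 0`, `s ≠ 0`,
and `ρ = 1/(yᵀs)`, then the BFGS update `B⁺` is invertible and
`(B⁺)⁻¹ = (I - ρ s yᵀ) B⁻¹ (I - ρ y sᵀ) + ρ s sᵀ`. -/
theorem bfgs_inverse_update (n : ℕ) (B : Matrix (Fin n) (Fin n) ℝ)
    (hBsymm : B.IsSymm) (hBpd : B.PosDef)
    (s y : Fin n → ℝ) (hcurv : 0 < s ⬝ᵥ y) (hs : s ≠ 0)
    (ρ : ℝ) (hρ : ρ = 1 / (y ⬝ᵥ s))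
    (Bplus : Matrix (Fin n) (Fin n) ℝ)
    (hBplus : Bplus = B - (1 / (s ⬝ᵥ (B *ᵥ s))) • (B * vecMulVec s s * B)
        + ρ • vecMulVec y y) :
    IsUnit Bplus ∧
      Bplus⁻¹ = ((1 : Matrix (Fin n) (Fin n) ℝ) - ρ • vecMulVec s y) * B⁻¹ *
          ((1 : Matrix (Fin n) (Fin n) ℝ) - ρ • vecMulVec y s) + ρ • vecMulVec s s := by
  have hσ : s ⬝ᵥ (B *ᵥ s) ≠ 0 := by
    simpa using (hBpd.dotProduct_mulVec_pos hs).ne'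
  have hys : y ⬝ᵥ s ≠ 0 := by rw [dotProduct_comm]; exact hcurv.ne'
  have hmul := bfgs_update_mul_inverse_update hBsymm hBpd.det_pos.ne'.isUnit hσ hys
  rw [hBplus, hρ, one_div, one_div]
  exact ⟨.of_mul_eq_one _ hmul, inv_eq_right_inv hmul⟩
end
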